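/- Let u : M⁺(ℝ^d) → ℝ be bounded, weakly continuous, with linear functional derivative δu. Fix n ∈ ℕ and x₁,…,xₙ ∈ ℝ^d, and define ū : (0,∞) → ℝ by ū(z) := u((z/n) Σᵢ₌₁ⁿ δ_{xᵢ}), where δ_x denotes the Dirac measure at x. Then ū is differentiable with ū'(z) = (1/n) Σₖ₌₁ⁿ δu((z/n) Σᵢ₌₁ⁿ δ_{xᵢ}, xₖ), and this derivative is continuous and bounded in (x₁,…,xₙ,z) on (ℝ^d)ⁿ × (0,∞). -/

import Mathlib

open MeasureTheory Set Filter Topology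
open scoped NNReal ENNReal

noncomputable section

/-- `ℝ^d`. -/
abbrev Eu (d : ℕ) : Type := EuclideanSpace ℝ (Fin d)

/-- `M⁺(ℝ^d)`, the finite positive Borel measures on `ℝ^d`, with the weak topology. -/
abbrev Md (d : ℕ) : Type := MeasureTheory.FiniteMeasure (Eu d)

variable {d : ℕ}

/-- The segment `t μ' + (1 - t) μ` in the space of finite measures. -/
noncomputable def seg (μ μ' : Md d) (t : ℝ) : Md d :=
  t.toNNReal • μ' + (1 - t).toNNReal • μ

/-- `⟨μ, ψ⟩ = ∫ ψ dμ`. -/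
noncomputable def pairing (μ : Md d) (ψ : Eu d → ℝ) : ℝ :=
  ∫ x, ψ x ∂(μ : Measure (Eu d))

/-- `δu` is a linear functional derivative of `u : M⁺(ℝ^d) → ℝ`: it is bounded, jointly
continuous (weak topology on measures), and satisfies the fundamental identity. -/
def IsLFD (u : Md d → ℝ) (δu : Md d → Eu d → ℝ) : Prop :=
  (∃ C : ℝ, ∀ (μ : Md d) (x : Eu d), |δu μ x| ≤ C) ∧
  Continuous (fun p : Md d × Eu d => δu p.1 p.2) ∧
  ∀ μ μ' : Md d,
    u μ' - u μ =
      ∫ t in (0:ℝ)..1,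
        (pairing μ' (fun x => δu (seg μ μ' t) x) - pairing μ (fun x => δu (seg μ μ' t) x))

/-- The Dirac measure at `x` as a finite measure. -/
noncomputable def diracFM (x : Eu d) : Md d := ⟨Measure.dirac x, inferInstance⟩

/-- The scaled empirical measure `(z/n) Σᵢ δ_{xᵢ}`. -/
def scaledEmpirical {n : ℕ} (X : Fin n → Eu d) (z : ℝ) : Md d :=
  (z / (n : ℝ)).toNNReal • ∑ i : Fin n, diracFM (X i)

lemma pairing_scaledEmpirical {n : ℕ} (X : Fin n → Eu d) (z : ℝ) (f : Eu d → ℝ) :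
    pairing (scaledEmpirical X z) f = ((z / (n : ℝ)).toNNReal : ℝ) * ∑ i, f (X i) := by
  have hsum : ((∑ i : Fin n, diracFM (X i) : Md d) : Measure (Eu d)) =
      ∑ i : Fin n, Measure.dirac (X i) := by
    rw [FiniteMeasure.toMeasure_sum]
    rfl
  unfold pairing scaledEmpirical
  rw [FiniteMeasure.toMeasure_smul, integral_smul_nnreal_measure, hsum,
    integral_finsetSum_measure fun i _ => integrable_dirac enorm_lt_top]
  simp only [integral_dirac, NNReal.smul_def, smul_eq_mul]

lemma continuous_scaledEmpirical {n : ℕ} :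
    Continuous fun p : (Fin n → Eu d) × ℝ => scaledEmpirical p.1 p.2 := by
  refine continuous_iff_continuousAt.2 fun p => ?_
  refine FiniteMeasure.tendsto_iff_forall_integral_tendsto.2 fun f => ?_
  change Tendsto (fun q : (Fin n → Eu d) × ℝ => pairing (scaledEmpirical q.1 q.2) f) (𝓝 p)
    (𝓝 (pairing (scaledEmpirical p.1 p.2) f))
  simp only [pairing_scaledEmpirical]
  refine Continuous.tendsto (f := fun q : (Fin n → Eu d) × ℝ =>
    ((q.2 / (n : ℝ)).toNNReal : ℝ) * ∑ i, f (q.1 i)) ?_ p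
  fun_prop

lemma seg_scaledEmpirical {n : ℕ} (X : Fin n → Eu d) {z w t : ℝ} (hz : 0 ≤ z) (hw : 0 ≤ w)
    (ht : t ∈ Icc (0 : ℝ) 1) :
    seg (scaledEmpirical X z) (scaledEmpirical X w) t =
      scaledEmpirical X (z + (w - z) * t) := by
  have h1 : 0 ≤ 1 - t := sub_nonneg.2 ht.2
  unfold seg scaledEmpirical
  rw [smul_smul, smul_smul, ← add_smul, ← Real.toNNReal_mul ht.1, ← Real.toNNReal_mul h1,
    ← Real.toNNReal_add (mul_nonneg ht.1 (by positivity)) (mul_nonneg h1 (by positivity))]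
  congr 2
  ring

/-- The average of `δu(μ, ·)` over the points `x₁,…,xₙ`, where `μ = (z/n) Σᵢ δ_{xᵢ}`. -/
def empiricalAverage {n : ℕ} (δu : Md d → Eu d → ℝ) (p : (Fin n → Eu d) × ℝ) : ℝ :=
  (1 / (n : ℝ)) * ∑ k : Fin n, δu (scaledEmpirical p.1 p.2) (p.1 k)

lemma continuous_empiricalAverage {n : ℕ} {δu : Md d → Eu d → ℝ}
    (h : Continuous fun p : Md d × Eu d => δu p.1 p.2) :
    Continuous (empiricalAverage (n := n) δu) := by
  refine continuous_const.mul (continuous_finsetSum _ fun k _ => ?_)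
  exact h.comp (continuous_scaledEmpirical.prodMk ((continuous_apply k).comp continuous_fst))

lemma abs_empiricalAverage_le {n : ℕ} {δu : Md d → Eu d → ℝ} {C : ℝ}
    (h : ∀ μ x, |δu μ x| ≤ C) (p : (Fin n → Eu d) × ℝ) : |empiricalAverage δu p| ≤ C := by
  have hC : 0 ≤ C := (abs_nonneg _).trans (h 0 0)
  have hsum : |∑ k : Fin n, δu (scaledEmpirical p.1 p.2) (p.1 k)| ≤ n * C := by
    refine (Finset.abs_sum_le_sum_abs _ _).trans
      ((Finset.sum_le_sum fun k _ => h _ _).trans ?_)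
    simp
  rw [empiricalAverage, abs_mul, abs_of_nonneg (by positivity : (0 : ℝ) ≤ 1 / n)]
  rcases Nat.eq_zero_or_pos n with rfl | hn
  · simpa using hC
  · have hn' : (0 : ℝ) < n := by exact_mod_cast hn
    rw [one_div, inv_mul_le_iff₀ hn']
    exact hsum

lemma IsLFD.sub_eq_integral {n : ℕ} {u : Md d → ℝ} {δu : Md d → Eu d → ℝ} (hu : IsLFD u δu)
    (X : Fin n → Eu d) {z w : ℝ} (hz : 0 ≤ z) (hw : 0 ≤ w) :
    u (scaledEmpirical X w) - u (scaledEmpirical X z) =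
      ∫ s in z..w, empiricalAverage δu (X, s) := by
  have key : ∀ t ∈ uIcc (0 : ℝ) 1,
      pairing (scaledEmpirical X w)
          (fun x => δu (seg (scaledEmpirical X z) (scaledEmpirical X w) t) x) -
        pairing (scaledEmpirical X z)
          (fun x => δu (seg (scaledEmpirical X z) (scaledEmpirical X w) t) x) =
      (w - z) * empiricalAverage δu (X, z + (w - z) * t) := by
    intro t ht
    rw [uIcc_of_le zero_le_one] at ht
    rw [seg_scaledEmpirical X hz hw ht, pairing_scaledEmpirical, pairing_scaledEmpirical,
      Real.coe_toNNReal _ (by positivity), Real.coe_toNNReal _ (by positivity), empiricalAverage]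
    ring
  rw [hu.2.2, intervalIntegral.integral_congr key, intervalIntegral.integral_const_mul,
    intervalIntegral.mul_integral_comp_add_mul (f := fun s => empiricalAverage δu (X, s))]
  simp

lemma IsLFD.hasDerivAt_scaledEmpirical {n : ℕ} {u : Md d → ℝ} {δu : Md d → Eu d → ℝ}
    (hu : IsLFD u δu) (X : Fin n → Eu d) {z : ℝ} (hz : 0 < z) :
    HasDerivAt (fun w => u (scaledEmpirical X w)) (empiricalAverage δu (X, z)) z := by
  have hcont : Continuous fun s : ℝ => empiricalAverage δu (X, s) :=
    (continuous_empiricalAverage hu.2.1).comp (by fun_prop)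
  have hint := (hcont.integral_hasStrictDerivAt z z).hasDerivAt.const_add
    (u (scaledEmpirical X z))
  refine hint.congr_of_eventuallyEq ?_
  filter_upwards [lt_mem_nhds hz] with w hw
  rw [← hu.sub_eq_integral X hz.le hw.le, add_sub_cancel]

/-- differentiability of the empirical projection with respect to the total
mass. If `u` is bounded, weakly continuous with linear functional derivative `δu`, then
for fixed `x₁,…,xₙ` the map `ū(z) = u((z/n) Σᵢ δ_{xᵢ})` is differentiable on `(0,∞)` with
`ū'(z) = (1/n) Σₖ δu((z/n) Σᵢ δ_{xᵢ}, xₖ)`, and this derivative is continuous and bounded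
in `(x₁,…,xₙ,z)` on `(ℝ^d)ⁿ × (0,∞)`. -/
theorem stmt13 {n : ℕ} (u : Md d → ℝ) (δu : Md d → Eu d → ℝ)
    (hub : ∃ C : ℝ, ∀ μ : Md d, |u μ| ≤ C) (huc : Continuous u) (hu : IsLFD u δu)
    (emp : (Fin n → Eu d) → ℝ → Md d)
    (hemp : emp = fun X z => (z / (n : ℝ)).toNNReal • ∑ i : Fin n, diracFM (X i))
    (F : (Fin n → Eu d) × ℝ → ℝ)
    (hF : F = fun p => (1 / (n : ℝ)) * ∑ k : Fin n, δu (emp p.1 p.2) (p.1 k)) :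
    (∀ (X : Fin n → Eu d) (z : ℝ), 0 < z →
      HasDerivAt (fun w : ℝ => u (emp X w)) (F (X, z)) z) ∧
    ContinuousOn F (Set.univ ×ˢ Set.Ioi (0:ℝ)) ∧
    (∃ C : ℝ, ∀ p : (Fin n → Eu d) × ℝ, 0 < p.2 → |F p| ≤ C) := by
  obtain rfl : emp = scaledEmpirical := hemp
  obtain rfl : F = empiricalAverage δu := hF
  obtain ⟨C, hC⟩ := hu.1
  exact ⟨fun X z hz => hu.hasDerivAt_scaledEmpirical X hz,
    (continuous_empiricalAverage hu.2.1).continuousOn,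
    C, fun p _ => abs_empiricalAverage_le hC p⟩

end
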